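/- arXiv:2506.22463 — 5 statements merged into one kernel-verified Lean document; each statement's English description precedes it below -/
import Mathlib

section
/- With the max-min dynamic quantizer, the squared quantization error satisfies the relative bound ‖x − Q(x)‖₂² ≤ 4d‖x‖₂²/(2^b − 1)². -/
/-- The squared spread of two coordinates is at most twice the squared Euclidean norm. -/
theorem EuclideanSpace.sub_sq_le_two_mul_norm_sq {ι : Type*} [Fintype ι]
    (x : EuclideanSpace ℝ ι) (i j : ι) : (x i - x j) ^ 2 ≤ 2 * ‖x‖ ^ 2 := by
  classical
  rcases eq_or_ne i j with rfl | hij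
  · simp
  · have hpair : x i ^ 2 + x j ^ 2 ≤ ‖x‖ ^ 2 := by
      rw [EuclideanSpace.real_norm_sq_eq, ← Finset.sum_pair (f := fun k => x k ^ 2) hij]
      exact Finset.sum_le_sum_of_subset_of_nonneg (Finset.subset_univ _)
        fun _ _ _ => sq_nonneg _
    nlinarith [sq_nonneg (x i + x j)]

/-- Rounding down relative to the zero point `⌊-m⌋` and clamping to `[0, N]` moves a real number
of `[m, m + N]` by at most one. -/
theorem abs_sub_clamp_floor_le_one {u m : ℝ} {N : ℤ} (hmu : m ≤ u)
    (huN : u - m ≤ N) :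
    |u - ((max 0 (min N (⌊u⌋ + ⌊-m⌋)) : ℤ) - (⌊-m⌋ : ℝ))| ≤ 1 := by
  have hu := Int.floor_le u
  have hu' := Int.lt_floor_add_one u
  have hm := Int.floor_le (-m)
  have hm' := Int.lt_floor_add_one (-m)
  have hle : ⌊u⌋ + ⌊-m⌋ ≤ N := by
    have : ((⌊u⌋ + ⌊-m⌋ : ℤ) : ℝ) ≤ N := by push_cast; linarith
    exact_mod_cast this
  have hge : -2 < ⌊u⌋ + ⌊-m⌋ := by
    have : ((-2 : ℤ) : ℝ) < ((⌊u⌋ + ⌊-m⌋ : ℤ) : ℝ) := by push_cast; linarith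
    exact_mod_cast this
  rw [min_eq_right hle, abs_le]
  rcases le_or_gt 0 (⌊u⌋ + ⌊-m⌋) with h | h
  · rw [max_eq_right h]
    push_cast
    constructor <;> linarith
  · rw [max_eq_left h.le]
    have : (⌊u⌋ : ℝ) + ⌊-m⌋ = -1 := by exact_mod_cast (by lia : ⌊u⌋ + ⌊-m⌋ = -1)
    push_cast
    constructor <;> linarith

/-- With the max-min dynamic quantizer, the squared quantization error satisfies the
relative bound `‖x − Q(x)‖₂² ≤ 4d‖x‖₂²/(2^b − 1)²`. -/
theorem maxmin_quantizer_relative_error_bound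
    {d : ℕ} (hd : 1 ≤ d) (b : ℕ) (hb : 1 ≤ b)
    (x : EuclideanSpace ℝ (Fin d)) (xmax xmin : ℝ)
    (hmax : IsGreatest (Set.range x) xmax)
    (hmin : IsLeast (Set.range x) xmin)
    (hlt : xmin < xmax)
    (s : ℝ) (hs : s = (xmax - xmin) / ((2 : ℝ) ^ b - 1))
    (z : ℤ) (hz : z = ⌊-xmin / s⌋)
    (xint : Fin d → ℤ)
    (hxint : ∀ i, xint i = max 0 (min ((2 : ℤ) ^ b - 1) (⌊x i / s⌋ + z)))
    (Qx : EuclideanSpace ℝ (Fin d))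
    (hQ : ∀ i, Qx i = s * ((xint i : ℝ) - (z : ℝ))) :
    ‖x - Qx‖ ^ 2 ≤ 4 * d * ‖x‖ ^ 2 / ((2 : ℝ) ^ b - 1) ^ 2 := by
  have hN : (0 : ℝ) < 2 ^ b - 1 := sub_pos.2 (one_lt_pow₀ one_lt_two (by lia))
  have hspos : 0 < s := hs ▸ div_pos (sub_pos.2 hlt) hN
  have hsN : s * (2 ^ b - 1) = xmax - xmin := by rw [hs, div_mul_cancel₀ _ hN.ne']
  have hcoord (i : Fin d) : (x i - Qx i) ^ 2 ≤ s ^ 2 := by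
    have hlow : xmin ≤ x i := hmin.2 ⟨i, rfl⟩
    have hupp : x i ≤ xmax := hmax.2 ⟨i, rfl⟩
    have hround := abs_sub_clamp_floor_le_one (u := x i / s) (m := xmin / s)
      (N := (2 : ℤ) ^ b - 1)
      (div_le_div_of_nonneg_right hlow hspos.le)
      (by
        push_cast
        rw [← sub_div, div_le_iff₀ hspos]
        linarith)
    rw [← neg_div, ← hz, ← hxint i] at hround
    have hfactor : x i - Qx i = s * (x i / s - (xint i - z)) := by
      rw [hQ i]
      field_simp
    rw [hfactor, mul_pow]
    exact mul_le_of_le_one_right (sq_nonneg s) ((sq_le_one_iff_abs_le_one _).2 hround)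
  have herr : ‖x - Qx‖ ^ 2 ≤ d * s ^ 2 := by
    rw [EuclideanSpace.real_norm_sq_eq]
    simpa using Finset.sum_le_sum fun i (_ : i ∈ Finset.univ) => hcoord i
  obtain ⟨i, hi⟩ := hmax.1
  obtain ⟨j, hj⟩ := hmin.1
  have hspread := EuclideanSpace.sub_sq_le_two_mul_norm_sq x i j
  rw [hi, hj, ← hsN, mul_pow] at hspread
  rw [le_div_iff₀ (by positivity)]
  calc ‖x - Qx‖ ^ 2 * ((2 : ℝ) ^ b - 1) ^ 2
      ≤ d * s ^ 2 * ((2 : ℝ) ^ b - 1) ^ 2 := by gcongr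
    _ = d * (s ^ 2 * ((2 : ℝ) ^ b - 1) ^ 2) := by ring
    _ ≤ d * (4 * ‖x‖ ^ 2) := mul_le_mul_of_nonneg_left (by linarith [sq_nonneg ‖x‖]) d.cast_nonneg
    _ = 4 * d * ‖x‖ ^ 2 := by ring
end

section
/- Under standard modulation with a quantizer satisfying the relative error bound, the accumulated estimation error satisfies, for every t ∈ {1, …, T−1}, ‖o_t − õ_t‖₂² ≤ Σ_{k=t}^{T−1} 2^{k−t+1} · c · ‖A‖₂² · ‖a_k − a_{k+1}‖₂² (i.e., the error accumulates with geometrically growing weights over the generation steps). -/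
/-- A backward recursion `e k ≤ 2 * (b k + e (k + 1))` ending at a nonpositive value unrolls to a
sum with geometric weights. -/
theorem le_sum_two_pow_mul_of_le_two_mul_add {e b : ℕ → ℝ} {t T : ℕ} (htT : t ≤ T)
    (hT : e T ≤ 0) (h : ∀ k, t ≤ k → k < T → e k ≤ 2 * (b k + e (k + 1))) :
    e t ≤ ∑ k ∈ Finset.Ico t T, (2 : ℝ) ^ (k - t + 1) * b k := by
  refine Nat.decreasingInduction'
    (P := fun j => e j ≤ ∑ k ∈ Finset.Ico j T, (2 : ℝ) ^ (k - j + 1) * b k) ?_ htT (by simpa)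
  intro j hjT htj ih
  have hsum : ∑ k ∈ Finset.Ico (j + 1) T, (2 : ℝ) ^ (k - j + 1) * b k =
      2 * ∑ k ∈ Finset.Ico (j + 1) T, (2 : ℝ) ^ (k - (j + 1) + 1) * b k := by
    rw [Finset.mul_sum]
    refine Finset.sum_congr rfl fun k hk => ?_
    have hjk : k - j = k - (j + 1) + 1 := by
      have := (Finset.mem_Ico.mp hk).1
      omega
    rw [hjk, pow_succ]
    ring
  rw [Finset.sum_eq_sum_Ico_succ_bot hjT, hsum]
  simp only [Nat.sub_self, zero_add, pow_one]
  linarith [h j htj hjT]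

/-- In a normed group, `‖x + y‖ ^ 2 ≤ 2 * (‖x‖ ^ 2 + ‖y‖ ^ 2)`. -/
theorem norm_add_sq_le_two_mul {E : Type*} [SeminormedAddCommGroup E] (x y : E) :
    ‖x + y‖ ^ 2 ≤ 2 * (‖x‖ ^ 2 + ‖y‖ ^ 2) :=
  (pow_le_pow_left₀ (norm_nonneg _) (norm_add_le x y) 2).trans add_sq_le

/-- Under standard modulation with a quantizer satisfying the relative error bound,
the accumulated estimation error satisfies, for every `t ∈ {1, …, T−1}`,
`‖o_t − õ_t‖₂² ≤ Σ_{k=t}^{T−1} 2^{k−t+1} · c · ‖A‖₂² · ‖a_k − a_{k+1}‖₂²`. -/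
theorem standard_modulation_accumulated_error_bound
    {n m : ℕ}
    (A : EuclideanSpace ℝ (Fin n) →L[ℝ] EuclideanSpace ℝ (Fin m))
    (T : ℕ) (hT : 1 ≤ T)
    (a : ℕ → EuclideanSpace ℝ (Fin n))
    (Q : EuclideanSpace ℝ (Fin n) → EuclideanSpace ℝ (Fin n))
    (o ot : ℕ → EuclideanSpace ℝ (Fin m))
    (ho : ∀ t, o t = A (a t))
    (hinit : ot T = A (a T))
    (hrec : ∀ t, 1 ≤ t → t < T → ot t = A (Q (a t - a (t + 1))) + ot (t + 1))
    (c : ℝ) (hc0 : 0 < c) (hc1 : c < 1 / 2)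
    (hQ : ∀ y : EuclideanSpace ℝ (Fin n), ‖y - Q y‖ ^ 2 ≤ c * ‖y‖ ^ 2) :
    ∀ t, 1 ≤ t → t < T →
      ‖o t - ot t‖ ^ 2 ≤
        ∑ k ∈ Finset.Icc t (T - 1),
          (2 : ℝ) ^ (k - t + 1) * c * ‖A‖ ^ 2 * ‖a k - a (k + 1)‖ ^ 2 := by
  intro t ht htT
  have hIcc : Finset.Icc t (T - 1) = Finset.Ico t T := by
    ext k
    simp only [Finset.mem_Icc, Finset.mem_Ico]
    omega
  have key := le_sum_two_pow_mul_of_le_two_mul_add (e := fun k => ‖o k - ot k‖ ^ 2)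
    (b := fun k => c * ‖A‖ ^ 2 * ‖a k - a (k + 1)‖ ^ 2) htT.le (by simp [ho, hinit]) ?_
  · simpa only [hIcc, mul_assoc] using key
  intro k htk hkT
  set x := a k - a (k + 1) with hx
  have herr : o k - ot k = A (x - Q x) + (o (k + 1) - ot (k + 1)) := by
    rw [hrec k (ht.trans htk) hkT, ho, ho, map_sub, hx, map_sub]
    abel
  have hA : ‖A (x - Q x)‖ ^ 2 ≤ c * ‖A‖ ^ 2 * ‖x‖ ^ 2 :=
    calc ‖A (x - Q x)‖ ^ 2 ≤ (‖A‖ * ‖x - Q x‖) ^ 2 := by gcongr; exact A.le_opNorm _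
      _ = ‖A‖ ^ 2 * ‖x - Q x‖ ^ 2 := mul_pow _ _ _
      _ ≤ ‖A‖ ^ 2 * (c * ‖x‖ ^ 2) := by gcongr; exact hQ x
      _ = c * ‖A‖ ^ 2 * ‖x‖ ^ 2 := by ring
  calc ‖o k - ot k‖ ^ 2
      ≤ 2 * (‖A (x - Q x)‖ ^ 2 + ‖o (k + 1) - ot (k + 1)‖ ^ 2) := by
        rw [herr]
        exact norm_add_sq_le_two_mul _ _
    _ ≤ 2 * (c * ‖A‖ ^ 2 * ‖x‖ ^ 2 + ‖o (k + 1) - ot (k + 1)‖ ^ 2) := by gcongr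
end

section
/- Under error-compensated modulation, the estimation error at step t equals exactly the current step's quantization error pushed through A, with no contribution from earlier steps: for every t ∈ {1, …, T−1}, o_t − ô_t = A( (a_t − â_{t+1}) − Q(a_t − â_{t+1}) ), and equivalently o_t − ô_t = A(a_t − â_t). -/
/-- Under error-compensated modulation, the estimation error at step `t` equals exactly
the current step's quantization error pushed through `A`:
`o_t − ô_t = A((a_t − â_{t+1}) − Q(a_t − â_{t+1}))`, and equivalently
`o_t − ô_t = A(a_t − â_t)`, for every `t ∈ {1, …, T−1}`. -/
theorem error_compensated_modulation_error_identity
    {n m : ℕ}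
    (A : EuclideanSpace ℝ (Fin n) →L[ℝ] EuclideanSpace ℝ (Fin m))
    (T : ℕ) (hT : 1 ≤ T)
    (a ah : ℕ → EuclideanSpace ℝ (Fin n))
    (Q : EuclideanSpace ℝ (Fin n) → EuclideanSpace ℝ (Fin n))
    (o oh : ℕ → EuclideanSpace ℝ (Fin m))
    (ho : ∀ t, o t = A (a t))
    (hahT : ah T = a T)
    (hohT : oh T = A (a T))
    (hahrec : ∀ t, 1 ≤ t → t < T → ah t = Q (a t - ah (t + 1)) + ah (t + 1))
    (hohrec : ∀ t, 1 ≤ t → t < T → oh t = A (Q (a t - ah (t + 1))) + oh (t + 1)) :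
    ∀ t, 1 ≤ t → t < T →
      o t - oh t = A ((a t - ah (t + 1)) - Q (a t - ah (t + 1))) ∧
        o t - oh t = A (a t - ah t) := by
  have oh_eq : ∀ t, t ≤ T → 1 ≤ t → oh t = A (ah t) := by
    intro t htT
    induction htT using Nat.decreasingInduction with
    | self => intro _; rw [hohT, hahT]
    | of_succ t ht ih =>
      intro h1
      rw [hohrec t h1 ht, hahrec t h1 ht, map_add, ih (by omega)]
  intro t h1 ht
  have hA : o t - oh t = A (a t - ah t) := by
    rw [ho, oh_eq t ht.le h1, map_sub]
  refine ⟨?_, hA⟩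
  rw [hA, hahrec t h1 ht, sub_add_eq_sub_sub_swap]
end

section
/- Under error-compensated modulation with a quantizer satisfying the relative error bound, the estimation error at step t is bounded by the current residual magnitude alone: for every t ∈ {1, …, T−1}, ‖o_t − ô_t‖₂² ≤ c‖A‖₂²‖a_t − â_{t+1}‖₂². -/
/-- The running output `oh` of error-compensated modulation is the image under `A` of the
running input estimate `ah`. -/
theorem modulated_output_eq_map_estimate {E F : Type*} [AddCommGroup E] [AddCommGroup F]
    (A : E →+ F) (T : ℕ) (q ah : ℕ → E) (oh : ℕ → F)
    (hT : oh T = A (ah T))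
    (hah : ∀ t, 1 ≤ t → t < T → ah t = q t + ah (t + 1))
    (hoh : ∀ t, 1 ≤ t → t < T → oh t = A (q t) + oh (t + 1))
    {t : ℕ} (ht : 1 ≤ t) (htT : t ≤ T) : oh t = A (ah t) := by
  induction htT using Nat.decreasingInduction with
  | self => exact hT
  | of_succ k hk ih =>
    rw [hoh k ht hk, ih (by omega), hah k ht hk, map_add]

/-- Under error-compensated modulation with a quantizer satisfying the relative error
bound, the estimation error at step `t` is bounded by the current residual magnitude
alone: `‖o_t − ô_t‖₂² ≤ c‖A‖₂²‖a_t − â_{t+1}‖₂²` for every `t ∈ {1, …, T−1}`. -/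
theorem error_compensated_modulation_error_bound
    {n m : ℕ}
    (A : EuclideanSpace ℝ (Fin n) →L[ℝ] EuclideanSpace ℝ (Fin m))
    (T : ℕ) (hT : 1 ≤ T)
    (a ah : ℕ → EuclideanSpace ℝ (Fin n))
    (Q : EuclideanSpace ℝ (Fin n) → EuclideanSpace ℝ (Fin n))
    (o oh : ℕ → EuclideanSpace ℝ (Fin m))
    (ho : ∀ t, o t = A (a t))
    (hahT : ah T = a T)
    (hohT : oh T = A (a T))
    (hahrec : ∀ t, 1 ≤ t → t < T → ah t = Q (a t - ah (t + 1)) + ah (t + 1))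
    (hohrec : ∀ t, 1 ≤ t → t < T → oh t = A (Q (a t - ah (t + 1))) + oh (t + 1))
    (c : ℝ) (hc0 : 0 < c) (hc1 : c < 1 / 2)
    (hQ : ∀ y : EuclideanSpace ℝ (Fin n), ‖y - Q y‖ ^ 2 ≤ c * ‖y‖ ^ 2) :
    ∀ t, 1 ≤ t → t < T →
      ‖o t - oh t‖ ^ 2 ≤ c * ‖A‖ ^ 2 * ‖a t - ah (t + 1)‖ ^ 2 := by
  intro t ht htT
  have hout : oh t = A (ah t) :=
    modulated_output_eq_map_estimate (A : _ →+ _) T (fun s => Q (a s - ah (s + 1))) ah oh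
      (by simp [hohT, hahT]) hahrec hohrec ht htT.le
  set r := a t - ah (t + 1) with hr
  have herr : o t - oh t = A (r - Q r) := by
    rw [ho, hout, ← map_sub, hahrec t ht htT, ← hr]
    congr 1
    rw [hr]
    abel
  calc ‖o t - oh t‖ ^ 2 = ‖A (r - Q r)‖ ^ 2 := by rw [herr]
    _ ≤ (‖A‖ * ‖r - Q r‖) ^ 2 := by gcongr; exact A.le_opNorm _
    _ = ‖A‖ ^ 2 * ‖r - Q r‖ ^ 2 := mul_pow _ _ _
    _ ≤ ‖A‖ ^ 2 * (c * ‖r‖ ^ 2) := by gcongr; exact hQ r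
    _ = c * ‖A‖ ^ 2 * ‖r‖ ^ 2 := by ring
end

section
/- Under error-compensated modulation with a quantizer satisfying the relative error bound, the contributions of past steps to the estimation error decay geometrically: for every t ∈ {1, …, T−1}, ‖o_t − ô_t‖₂² ≤ Σ_{k=t}^{T−1} (2c)^{k−t+1} · ‖A‖₂² · ‖a_k − a_{k+1}‖₂², where 2c < 1 so the weight of the k-th past residual decays exponentially in k − t. -/
/-- A backward recursion `e t ≤ r * (d t + e (t + 1))` that terminates with `e T ≤ 0` unrolls to a
geometrically weighted sum. -/
theorem le_sum_Ico_pow_mul_of_backward_recursion {r : ℝ} (hr : 0 ≤ r) {s T : ℕ} {e d : ℕ → ℝ}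
    (hT : e T ≤ 0) (h : ∀ t, s ≤ t → t < T → e t ≤ r * (d t + e (t + 1)))
    {t : ℕ} (hst : s ≤ t) (htT : t ≤ T) :
    e t ≤ ∑ k ∈ Finset.Ico t T, r ^ (k - t + 1) * d k := by
  induction htT using Nat.decreasingInduction with
  | self => simpa using hT
  | of_succ t htT ih =>
    rw [Finset.sum_eq_sum_Ico_succ_bot htT]
    have hsum : ∑ k ∈ Finset.Ico (t + 1) T, r ^ (k - t + 1) * d k =
        r * ∑ k ∈ Finset.Ico (t + 1) T, r ^ (k - (t + 1) + 1) * d k := by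
      rw [Finset.mul_sum]
      refine Finset.sum_congr rfl fun k hk => ?_
      have hk' : k - t = k - (t + 1) + 1 := by
        have := (Finset.mem_Ico.mp hk).1
        omega
      rw [hk', pow_succ' r (k - (t + 1) + 1), mul_assoc]
    calc e t ≤ r * (d t + e (t + 1)) := h t hst htT
      _ ≤ r * (d t + ∑ k ∈ Finset.Ico (t + 1) T, r ^ (k - (t + 1) + 1) * d k) := by
        gcongr
        exact ih (by omega)
      _ = _ := by rw [hsum, Nat.sub_self, zero_add, pow_one, mul_add]

/-- Under error-compensated modulation with a quantizer satisfying the relative error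
bound, the contributions of past steps to the estimation error decay geometrically:
`‖o_t − ô_t‖₂² ≤ Σ_{k=t}^{T−1} (2c)^{k−t+1} · ‖A‖₂² · ‖a_k − a_{k+1}‖₂²`
for every `t ∈ {1, …, T−1}` (with `2c < 1` since `c < 1/2`). -/
theorem error_compensated_modulation_geometric_error_bound
    {n m : ℕ}
    (A : EuclideanSpace ℝ (Fin n) →L[ℝ] EuclideanSpace ℝ (Fin m))
    (T : ℕ) (hT : 1 ≤ T)
    (a ah : ℕ → EuclideanSpace ℝ (Fin n))
    (Q : EuclideanSpace ℝ (Fin n) → EuclideanSpace ℝ (Fin n))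
    (o oh : ℕ → EuclideanSpace ℝ (Fin m))
    (ho : ∀ t, o t = A (a t))
    (hahT : ah T = a T)
    (hohT : oh T = A (a T))
    (hahrec : ∀ t, 1 ≤ t → t < T → ah t = Q (a t - ah (t + 1)) + ah (t + 1))
    (hohrec : ∀ t, 1 ≤ t → t < T → oh t = A (Q (a t - ah (t + 1))) + oh (t + 1))
    (c : ℝ) (hc0 : 0 < c) (hc1 : c < 1 / 2)
    (hQ : ∀ y : EuclideanSpace ℝ (Fin n), ‖y - Q y‖ ^ 2 ≤ c * ‖y‖ ^ 2) :
    ∀ t, 1 ≤ t → t < T →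
      ‖o t - oh t‖ ^ 2 ≤
        ∑ k ∈ Finset.Icc t (T - 1),
          (2 * c) ^ (k - t + 1) * ‖A‖ ^ 2 * ‖a k - a (k + 1)‖ ^ 2 := by
  intro t ht htT
  have hoh : ∀ s ≤ T, 1 ≤ s → oh s = A (ah s) := by
    intro s hs
    induction hs using Nat.decreasingInduction with
    | self => intro _; rw [hohT, hahT]
    | of_succ s hs ih =>
      intro h1
      rw [hohrec s h1 hs, hahrec s h1 hs, map_add, ih (by omega)]
  have hrec : ∀ s, 1 ≤ s → s < T → ‖a s - ah s‖ ^ 2 ≤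
      2 * c * (‖a s - a (s + 1)‖ ^ 2 + ‖a (s + 1) - ah (s + 1)‖ ^ 2) := by
    intro s h1 hs
    have herr : a s - ah s = (a s - ah (s + 1)) - Q (a s - ah (s + 1)) := by
      rw [hahrec s h1 hs]
      abel
    have hsplit := norm_add_sq_le_two_mul (a s - a (s + 1)) (a (s + 1) - ah (s + 1))
    rw [sub_add_sub_cancel] at hsplit
    calc ‖a s - ah s‖ ^ 2 ≤ c * ‖a s - ah (s + 1)‖ ^ 2 := by
          rw [herr]
          exact hQ _
      _ ≤ c * (2 * (‖a s - a (s + 1)‖ ^ 2 + ‖a (s + 1) - ah (s + 1)‖ ^ 2)) := by gcongr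
      _ = _ := by ring
  have hinput := le_sum_Ico_pow_mul_of_backward_recursion (e := fun s => ‖a s - ah s‖ ^ 2)
    (d := fun s => ‖a s - a (s + 1)‖ ^ 2) (by positivity) (by simp [hahT]) hrec ht htT.le
  have hIcc : Finset.Icc t (T - 1) = Finset.Ico t T := by
    ext k
    simp only [Finset.mem_Icc, Finset.mem_Ico]
    omega
  calc ‖o t - oh t‖ ^ 2 = ‖A (a t - ah t)‖ ^ 2 := by rw [ho, hoh t htT.le ht, map_sub]
    _ ≤ (‖A‖ * ‖a t - ah t‖) ^ 2 := by
      gcongr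
      exact A.le_opNorm _
    _ = ‖A‖ ^ 2 * ‖a t - ah t‖ ^ 2 := mul_pow _ _ _
    _ ≤ ‖A‖ ^ 2 * ∑ k ∈ Finset.Ico t T, (2 * c) ^ (k - t + 1) * ‖a k - a (k + 1)‖ ^ 2 := by
      gcongr
    _ = _ := by
      rw [hIcc, Finset.mul_sum]
      exact Finset.sum_congr rfl fun k _ => by ring
end
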